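/- Let w₁, w₂, w₃ be nonzero complex numbers with w₁², w₂², w₃² pairwise distinct, and assume detB∘ ≠ 0; set u₀ := w₁w₂w₃ · detA∘ / detB∘. Then each of the following seven sets is concyclic-or-collinear: {w₂², w₃², w₂w₃, u₀}, {w₁², w₃², w₁w₃, u₀}, {w₁², w₂², w₁w₂, u₀}, {−w₁w₂, −w₁w₃, −w₂w₃, u₀}, {−w₁w₂, w₁w₃, w₂w₃, u₀}, {w₁w₂, −w₁w₃, w₂w₃, u₀}, and {w₁w₂, w₁w₃, −w₂w₃, u₀}. -/

import Mathlib

open ComplexConjugate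

/-- A finite set of points in `ℂ` lies on a common circle or on a common real line. -/
def ConcyclicOrCollinear (S : Set ℂ) : Prop :=
  (∃ z₀ : ℂ, ∃ r : ℝ, ∀ z ∈ S, ‖z - z₀‖ = r) ∨ Collinear ℝ S

/-- If the vector `v` is nonzero and `s` is parallel to `v`, then `s` is a real multiple of `v`. -/
theorem exists_real_smul_of_mul_conj_eq {s v : ℂ} (hv : v ≠ 0)
    (h : s * conj v = conj s * v) : ∃ r : ℝ, s = r • v := by
  have hv' : conj v ≠ 0 := (map_ne_zero _).2 hv
  obtain ⟨r, hr⟩ := Complex.conj_eq_iff_real.1 (show conj (s / v) = s / v by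
    rw [map_div₀, div_eq_div_iff hv' hv, h])
  refine ⟨r, ?_⟩
  rw [Complex.real_smul, ← hr, div_mul_cancel₀ _ hv]

/-- Four points `a, b, c, d`, the first three distinct, are concyclic or collinear when the
circle determinant of `b - a`, `c - a`, `d - a` vanishes. -/
theorem concyclicOrCollinear_of_det_eq_zero {a b c d : ℂ}
    (hab : b ≠ a) (hac : c ≠ a) (hbc : b ≠ c)
    (h : (d - a) * conj (d - a) * ((b - a) * conj (c - a) - conj (b - a) * (c - a))
      - (d - a) * (conj (b - a) * conj (c - a) * (b - c))
      + conj (d - a) * ((b - a) * (c - a) * conj (b - c)) = 0) :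
    ConcyclicOrCollinear {a, b, c, d} := by
  by_cases hD : (b - a) * conj (c - a) - conj (b - a) * (c - a) = 0
  · right
    have hp : b - a ≠ 0 := sub_ne_zero.2 hab
    have hq' : conj (c - a) ≠ 0 := (map_ne_zero _).2 (sub_ne_zero.2 hac)
    rw [collinear_iff_of_mem (p₀ := a) (by simp)]
    refine ⟨b - a, fun z hz => ?_⟩
    suffices hz' : (z - a) * conj (b - a) = conj (z - a) * (b - a) by
      obtain ⟨r, hr⟩ := exists_real_smul_of_mul_conj_eq hp hz'
      exact ⟨r, by rw [← hr]; simp⟩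
    simp only [Set.mem_insert_iff, Set.mem_singleton_iff] at hz
    rcases hz with rfl | rfl | rfl | rfl
    · simp
    · ring
    · linear_combination -hD
    · refine mul_left_cancel₀ (mul_ne_zero hq' (sub_ne_zero.2 hbc)) ?_
      simp only [map_sub] at h hD ⊢
      linear_combination (-1 : ℂ) * h + ((z - a) * (conj z - conj a)
        - (conj z - conj a) * (b - a)) * hD
  · left
    set D := (b - a) * conj (c - a) - conj (b - a) * (c - a) with hDdef
    have hDc : conj D = -D := by simp [hDdef]
    set e := -((b - a) * (c - a) * conj (b - c)) / D with he
    have hec : conj e = conj (b - a) * conj (c - a) * (b - c) / D := by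
      rw [he, map_div₀, hDc, div_neg, ← neg_div]
      simp
    refine ⟨a + e, ‖e‖, fun z hz => ?_⟩
    suffices hz' : (z - a) * conj (z - a) * D - (z - a) * (conj (b - a) * conj (c - a) * (b - c))
        + conj (z - a) * ((b - a) * (c - a) * conj (b - c)) = 0 by
      have hs : (z - (a + e)) * conj (z - (a + e)) = e * conj e := by
        have h1 : e * D = -((b - a) * (c - a) * conj (b - c)) := div_mul_cancel₀ _ hD
        have h2 : conj e * D = conj (b - a) * conj (c - a) * (b - c) := by
          rw [hec, div_mul_cancel₀ _ hD]
        refine mul_right_cancel₀ hD ?_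
        rw [← h2, ← neg_eq_iff_eq_neg.2 h1] at hz'
        simp only [map_sub, map_add] at hz' ⊢
        linear_combination hz'
      rw [Complex.mul_conj', Complex.mul_conj'] at hs
      exact (sq_eq_sq₀ (norm_nonneg _) (norm_nonneg _)).1 (by exact_mod_cast hs)
    simp only [Set.mem_insert_iff, Set.mem_singleton_iff] at hz
    rcases hz with rfl | rfl | rfl | rfl
    · simp
    · simp only [hDdef, map_sub]; ring
    · simp only [hDdef, map_sub]; ring
    · exact h

/-- The expansion of the determinant `detA`. -/
def expandedDetA (x₁ x₂ x₃ y₁ y₂ y₃ : ℂ) : ℂ :=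
  y₁ * y₂ * (x₂ * y₁ - x₁ * y₂) - y₁ * y₃ * (x₃ * y₁ - x₁ * y₃)
    + y₂ * y₃ * (x₃ * y₂ - x₂ * y₃)

/-- The expansion of the determinant `detB`. -/
def expandedDetB (x₁ x₂ x₃ y₁ y₂ y₃ : ℂ) : ℂ :=
  x₁ * y₁ ^ 2 * (y₂ * x₃ - y₃ * x₂) - x₂ * y₂ ^ 2 * (y₁ * x₃ - y₃ * x₁)
    + x₃ * y₃ ^ 2 * (y₁ * x₂ - y₂ * x₁)

/-- `u` is the point `w₁ w₂ w₃ detA / detB`, with `detB` nonzero. -/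
def IsCommonPoint (w₁ w₂ w₃ u : ℂ) : Prop :=
  expandedDetB w₁ w₂ w₃ (conj w₁) (conj w₂) (conj w₃) ≠ 0 ∧
    u * expandedDetB w₁ w₂ w₃ (conj w₁) (conj w₂) (conj w₃) =
      w₁ * w₂ * w₃ * expandedDetA w₁ w₂ w₃ (conj w₁) (conj w₂) (conj w₃)

namespace IsCommonPoint

variable {w₁ w₂ w₃ u : ℂ}

theorem swap (h : IsCommonPoint w₁ w₂ w₃ u) : IsCommonPoint w₂ w₁ w₃ u := by
  obtain ⟨hB, hu⟩ := h
  simp only [IsCommonPoint, expandedDetA, expandedDetB] at *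
  refine ⟨fun h => hB (by linear_combination -h), by linear_combination -hu⟩

theorem rotate (h : IsCommonPoint w₁ w₂ w₃ u) : IsCommonPoint w₂ w₃ w₁ u := by
  obtain ⟨hB, hu⟩ := h
  simp only [IsCommonPoint, expandedDetA, expandedDetB] at *
  refine ⟨fun h => hB (by linear_combination h), by linear_combination hu⟩

theorem neg (h : IsCommonPoint w₁ w₂ w₃ u) : IsCommonPoint (-w₁) w₂ w₃ u := by
  obtain ⟨hB, hu⟩ := h
  simp only [IsCommonPoint, expandedDetA, expandedDetB, map_neg] at *
  refine ⟨fun h => hB (by linear_combination -h), by linear_combination -hu⟩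

theorem conj_mul_eq (h : IsCommonPoint w₁ w₂ w₃ u) :
    conj u * expandedDetB (conj w₁) (conj w₂) (conj w₃) w₁ w₂ w₃ =
      conj w₁ * conj w₂ * conj w₃ * expandedDetA (conj w₁) (conj w₂) (conj w₃) w₁ w₂ w₃ := by
  simpa [expandedDetA, expandedDetB] using congrArg conj h.2

theorem conj_ne_zero (h : IsCommonPoint w₁ w₂ w₃ u) :
    expandedDetB (conj w₁) (conj w₂) (conj w₃) w₁ w₂ w₃ ≠ 0 := by
  simpa [expandedDetA, expandedDetB] using (map_ne_zero (starRingEnd ℂ)).2 h.1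

/-- To show that a circle equation holds at `u`, clear denominators. -/
theorem circle_equation (h : IsCommonPoint w₁ w₂ w₃ u) {α β γ a a' A A' B B' : ℂ}
    (hA : A = expandedDetA w₁ w₂ w₃ (conj w₁) (conj w₂) (conj w₃))
    (hA' : A' = expandedDetA (conj w₁) (conj w₂) (conj w₃) w₁ w₂ w₃)
    (hB : B = expandedDetB w₁ w₂ w₃ (conj w₁) (conj w₂) (conj w₃))
    (hB' : B' = expandedDetB (conj w₁) (conj w₂) (conj w₃) w₁ w₂ w₃)
    (hc : (w₁ * w₂ * w₃ * A - a * B) * (conj w₁ * conj w₂ * conj w₃ * A' - a' * B') * α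
      - (w₁ * w₂ * w₃ * A - a * B) * B' * β
      + (conj w₁ * conj w₂ * conj w₃ * A' - a' * B') * B * γ = 0) :
    (u - a) * (conj u - a') * α - (u - a) * β + (conj u - a') * γ = 0 := by
  have h1 := h.2
  have h2 := h.conj_mul_eq
  have h3 := h.1
  have h4 := h.conj_ne_zero
  rw [← hA, ← hB] at h1
  rw [← hA', ← hB'] at h2
  rw [← hB] at h3
  rw [← hB'] at h4
  rw [← h1, ← h2] at hc
  refine mul_left_cancel₀ (mul_ne_zero h3 h4) ?_
  linear_combination hc

theorem concyclicOrCollinear_squares (h : IsCommonPoint w₁ w₂ w₃ u)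
    (h₂ : w₂ ≠ 0) (h₃ : w₃ ≠ 0) (h23 : w₂ ^ 2 ≠ w₃ ^ 2) :
    ConcyclicOrCollinear {w₂ ^ 2, w₃ ^ 2, w₂ * w₃, u} := by
  have hne : w₂ ≠ w₃ := fun e => h23 (by rw [e])
  have hset : ({w₂ ^ 2, w₃ ^ 2, w₂ * w₃, u} : Set ℂ) = {w₂ * w₃, w₂ ^ 2, w₃ ^ 2, u} := by
    ext; simp; tauto
  rw [hset]
  refine concyclicOrCollinear_of_det_eq_zero ?_ ?_ h23 ?_
  · intro e
    exact hne (mul_left_cancel₀ h₂ (by linear_combination e))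
  · intro e
    exact hne (mul_right_cancel₀ h₃ (by linear_combination -e))
  · simp only [map_sub, map_mul, map_pow]
    refine h.circle_equation rfl rfl rfl rfl ?_
    simp only [expandedDetA, expandedDetB]
    ring

theorem concyclicOrCollinear_neg_products (h : IsCommonPoint w₁ w₂ w₃ u)
    (h₁ : w₁ ≠ 0) (h₂ : w₂ ≠ 0) (h₃ : w₃ ≠ 0)
    (h12 : w₁ ≠ w₂) (h13 : w₁ ≠ w₃) (h23 : w₂ ≠ w₃) :
    ConcyclicOrCollinear {-(w₁ * w₂), -(w₁ * w₃), -(w₂ * w₃), u} := by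
  refine concyclicOrCollinear_of_det_eq_zero ?_ ?_ ?_ ?_
  · intro e
    exact h23 (mul_left_cancel₀ h₁ (by linear_combination e))
  · intro e
    exact h13 (mul_left_cancel₀ h₂ (by linear_combination e))
  · intro e
    exact h12 (mul_right_cancel₀ h₃ (by linear_combination -e))
  · simp only [map_sub, map_mul, map_neg]
    refine h.circle_equation rfl rfl rfl rfl ?_
    simp only [expandedDetA, expandedDetB]
    ring

end IsCommonPoint

theorem stmt_17 (w₁ w₂ w₃ : ℂ)
    (h₁ : w₁ ≠ 0) (h₂ : w₂ ≠ 0) (h₃ : w₃ ≠ 0)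
    (h12 : w₁ ^ 2 ≠ w₂ ^ 2) (h13 : w₁ ^ 2 ≠ w₃ ^ 2) (h23 : w₂ ^ 2 ≠ w₃ ^ 2)
    (detA detB u₀ : ℂ)
    (hdetA : detA = Matrix.det
      !![conj w₁ * conj w₂, conj w₁ * conj w₃, conj w₂ * conj w₃;
         w₃, w₂, w₁;
         conj w₃, conj w₂, conj w₁])
    (hdetB : detB = Matrix.det
      !![w₁ * (conj w₁) ^ 2, w₂ * (conj w₂) ^ 2, w₃ * (conj w₃) ^ 2;
         conj w₁, conj w₂, conj w₃;
         w₁, w₂, w₃])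
    (hB : detB ≠ 0)
    (hu₀ : u₀ = w₁ * w₂ * w₃ * detA / detB) :
    ConcyclicOrCollinear {w₂ ^ 2, w₃ ^ 2, w₂ * w₃, u₀} ∧
    ConcyclicOrCollinear {w₁ ^ 2, w₃ ^ 2, w₁ * w₃, u₀} ∧
    ConcyclicOrCollinear {w₁ ^ 2, w₂ ^ 2, w₁ * w₂, u₀} ∧
    ConcyclicOrCollinear {-(w₁ * w₂), -(w₁ * w₃), -(w₂ * w₃), u₀} ∧
    ConcyclicOrCollinear {-(w₁ * w₂), w₁ * w₃, w₂ * w₃, u₀} ∧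
    ConcyclicOrCollinear {w₁ * w₂, -(w₁ * w₃), w₂ * w₃, u₀} ∧
    ConcyclicOrCollinear {w₁ * w₂, w₁ * w₃, -(w₂ * w₃), u₀} := by
  have h : IsCommonPoint w₁ w₂ w₃ u₀ := by
    have hA' : detA = expandedDetA w₁ w₂ w₃ (conj w₁) (conj w₂) (conj w₃) := by
      rw [hdetA, Matrix.det_fin_three]
      simp [expandedDetA]
      ring
    have hB' : detB = expandedDetB w₁ w₂ w₃ (conj w₁) (conj w₂) (conj w₃) := by
      rw [hdetB, Matrix.det_fin_three]
      simp [expandedDetB]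
      ring
    refine ⟨hB' ▸ hB, ?_⟩
    rw [← hA', ← hB', hu₀, div_mul_cancel₀ _ hB]
  obtain ⟨n12, m12⟩ := not_or.1 (mt sq_eq_sq_iff_eq_or_eq_neg.2 h12)
  obtain ⟨n13, m13⟩ := not_or.1 (mt sq_eq_sq_iff_eq_or_eq_neg.2 h13)
  obtain ⟨n23, m23⟩ := not_or.1 (mt sq_eq_sq_iff_eq_or_eq_neg.2 h23)
  refine ⟨h.concyclicOrCollinear_squares h₂ h₃ h23,
    h.swap.concyclicOrCollinear_squares h₁ h₃ h13,
    h.rotate.rotate.concyclicOrCollinear_squares h₁ h₂ h12,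
    h.concyclicOrCollinear_neg_products h₁ h₂ h₃ n12 n13 n23, ?_, ?_, ?_⟩
  · have := h.rotate.rotate.neg.rotate.concyclicOrCollinear_neg_products h₁ h₂ (neg_ne_zero.2 h₃)
      n12 m13 m23
    simpa using this
  · have := h.swap.neg.swap.concyclicOrCollinear_neg_products h₁ (neg_ne_zero.2 h₂) h₃
      m12 n13 (fun e => m23 (neg_eq_iff_eq_neg.1 e))
    simpa using this
  · have := h.neg.concyclicOrCollinear_neg_products (neg_ne_zero.2 h₁) h₂ h₃
      (fun e => m12 (neg_eq_iff_eq_neg.1 e)) (fun e => m13 (neg_eq_iff_eq_neg.1 e)) n23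
    simpa using this
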